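/- Let (X,d) be a compact metric space and let f : X → X be a continuous map having the L-Lipschitz shadowing property with constants 0 < L < 1 and δ₀ > 0. Let C be a chain component of f and let x ∈ X. If d(x,C) ≤ δ₀ and lim_{i→∞} d(f^i(x), C) = 0, then x ∈ C. -/

import Mathlib

open Metric Set Function

/-- A finite sequence `c 0, c 1, ..., c k` (with `k ≥ 1`) is a `δ`-chain of `f` if
`dist (f (c i)) (c (i+1)) ≤ δ` for all `0 ≤ i ≤ k-1`. -/
def IsDeltaChain {X : Type*} [MetricSpace X] (f : X → X) (δ : ℝ) (c : ℕ → X) (k : ℕ) : Prop :=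
  1 ≤ k ∧ ∀ i < k, dist (f (c i)) (c (i + 1)) ≤ δ

/-- `x → y` : for every `δ > 0` there is a `δ`-chain of `f` from `x` to `y`. -/
def ChainReach {X : Type*} [MetricSpace X] (f : X → X) (x y : X) : Prop :=
  ∀ δ : ℝ, 0 < δ → ∃ (c : ℕ → X) (k : ℕ), IsDeltaChain f δ c k ∧ c 0 = x ∧ c k = y

/-- The chain recurrent set `CR(f) = {x | x → x}`. -/
def chainRecurrentSet {X : Type*} [MetricSpace X] (f : X → X) : Set X :=
  {x | ChainReach f x x}

/-- The set of chain components of `f`: equivalence classes of `↔` on `CR(f)`. -/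
def chainComponents {X : Type*} [MetricSpace X] (f : X → X) : Set (Set X) :=
  {C | ∃ x ∈ chainRecurrentSet f,
    C = {y ∈ chainRecurrentSet f | ChainReach f x y ∧ ChainReach f y x}}

/-- `f` is ball expanding with constants `L`, `δ₀`. -/
def BallExpandingWith {X : Type*} [MetricSpace X] (f : X → X) (L δ₀ : ℝ) : Prop :=
  ∀ (x : X) (δ : ℝ), 0 < δ → δ ≤ δ₀ → closedBall (f x) δ ⊆ f '' closedBall x (L * δ)

/-- `f` is ball expanding: there are `0 < L < 1` and `δ₀ > 0` with
`B_δ(f x) ⊆ f (B_{Lδ} x)` for all `x` and `0 < δ ≤ δ₀`. -/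
def BallExpanding {X : Type*} [MetricSpace X] (f : X → X) : Prop :=
  ∃ L δ₀ : ℝ, 0 < L ∧ L < 1 ∧ 0 < δ₀ ∧ BallExpandingWith f L δ₀

/-- A closed `f`-invariant set `S` is chain stable. -/
def ChainStable {X : Type*} [MetricSpace X] (f : X → X) (S : Set X) : Prop :=
  ∀ ε : ℝ, 0 < ε → ∃ δ : ℝ, 0 < δ ∧ ∀ (c : ℕ → X) (k : ℕ),
    IsDeltaChain f δ c k → c 0 ∈ S → infDist (c k) S ≤ ε

/-- `f` has the h-shadowing property. -/
def HShadowing {X : Type*} [MetricSpace X] (f : X → X) : Prop :=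
  ∀ ε : ℝ, 0 < ε → ∃ δ : ℝ, 0 < δ ∧ ∀ (c : ℕ → X) (k : ℕ), IsDeltaChain f δ c k →
    ∃ x : X, (∀ i < k, dist (f^[i] x) (c i) ≤ ε) ∧ f^[k] x = c k

/-- `f` has the `L`-Lipschitz shadowing property with constant `δ₀`. -/
def LipschitzShadowingWith {X : Type*} [MetricSpace X] (f : X → X) (L δ₀ : ℝ) : Prop :=
  ∀ δ : ℝ, 0 < δ → δ ≤ δ₀ → ∀ ξ : ℕ → X, (∀ i : ℕ, dist (f (ξ i)) (ξ (i + 1)) ≤ δ) →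
    ∃ x : X, ∀ i : ℕ, dist (f^[i] x) (ξ i) ≤ L * δ


/-- `y` lies within `δ` of the image of `x`. -/
def DeltaStep {X : Type*} [MetricSpace X] (f : X → X) (δ : ℝ) (x y : X) : Prop :=
  dist (f x) y ≤ δ

section Chains

variable {X : Type*} [MetricSpace X] {f : X → X}

open Relation

theorem transGen_deltaStep_iff {δ : ℝ} {x y : X} :
    TransGen (DeltaStep f δ) x y ↔
      ∃ (c : ℕ → X) (k : ℕ), IsDeltaChain f δ c k ∧ c 0 = x ∧ c k = y := by
  constructor
  · intro h
    induction h with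
    | @single b hb =>
      refine ⟨fun i => if i = 0 then x else b, 1, ⟨le_rfl, ?_⟩, by simp, by simp⟩
      intro i hi
      obtain rfl : i = 0 := by omega
      simpa [DeltaStep] using hb
    | @tail b d _ hbd ih =>
      obtain ⟨c, k, ⟨hk, hc⟩, h0, hck⟩ := ih
      refine ⟨fun i => if i ≤ k then c i else d, k + 1, ⟨by omega, ?_⟩, by simpa using h0,
        by simp⟩
      intro i hi
      rcases Nat.lt_or_ge i k with hik | hik
      · simpa [hik.le, Nat.succ_le_of_lt hik] using hc i hik
      · obtain rfl : i = k := by omega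
        simpa [hck, DeltaStep] using hbd
  · rintro ⟨c, k, ⟨hk, hc⟩, rfl, rfl⟩
    induction k, hk using Nat.le_induction with
    | base => exact .single (hc 0 (by omega))
    | succ k hk ih => exact (ih fun i hi => hc i (by omega)).tail (hc k (by omega))

theorem chainReach_iff_transGen {x y : X} :
    ChainReach f x y ↔ ∀ δ : ℝ, 0 < δ → TransGen (DeltaStep f δ) x y :=
  forall₂_congr fun _ _ => transGen_deltaStep_iff.symm

theorem ChainReach.trans {x y z : X} (hxy : ChainReach f x y) (hyz : ChainReach f y z) :
    ChainReach f x z := by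
  rw [chainReach_iff_transGen] at *
  exact fun δ hδ => (hxy δ hδ).trans (hyz δ hδ)

theorem transGen_deltaStep_mono {δ ε : ℝ} (h : δ ≤ ε) {x y : X}
    (hxy : TransGen (DeltaStep f δ) x y) : TransGen (DeltaStep f ε) x y :=
  TransGen.mono (p := DeltaStep f ε) (fun _ _ hab => le_trans hab h) x y hxy

theorem transGen_deltaStep_of_dist_le {δ ε : ℝ} {x y z : X}
    (hxy : TransGen (DeltaStep f δ) x y) (hyz : dist y z ≤ ε) :
    TransGen (DeltaStep f (δ + ε)) x z := by
  have hε : 0 ≤ ε := dist_nonneg.trans hyz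
  have key {w : X} (hw : DeltaStep f δ w y) : DeltaStep f (δ + ε) w z :=
    (dist_triangle _ _ _).trans (add_le_add hw hyz)
  cases hxy with
  | single h => exact .single (key h)
  | tail h h' => exact (transGen_deltaStep_mono (by linarith) h).tail (key h')

theorem reflTransGen_deltaStep_iterate {δ : ℝ} (hδ : 0 ≤ δ) (x : X) (n : ℕ) :
    ReflTransGen (DeltaStep f δ) x (f^[n] x) := by
  induction n with
  | zero => exact .refl
  | succ n ih =>
    refine ih.tail ?_
    rw [iterate_succ_apply', DeltaStep, dist_self]
    exact hδ

theorem chainReach_of_mem_closure {p y : X} {S : Set X} (hS : ∀ q ∈ S, ChainReach f p q)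
    (hy : y ∈ closure S) : ChainReach f p y := by
  rw [chainReach_iff_transGen]
  intro δ hδ
  obtain ⟨q, hq, hyq⟩ := Metric.mem_closure_iff.1 hy (δ / 2) (half_pos hδ)
  have h := transGen_deltaStep_of_dist_le
    (chainReach_iff_transGen.1 (hS q hq) (δ / 2) (half_pos hδ)) (dist_comm y q ▸ hyq.le)
  rwa [add_halves] at h

/-- A point reachable by chains from a chain recurrent point `p` has a preimage that is also
reachable from `p`. -/
theorem ChainReach.exists_preimage [CompactSpace X] (hf : Continuous f) {p y : X}
    (hp : ChainReach f p p) (hy : ChainReach f p y) : ∃ w, f w = y ∧ ChainReach f p w := by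
  rw [chainReach_iff_transGen] at hp hy
  have hpos (n : ℕ) : (0 : ℝ) < 1 / ((n : ℝ) + 1) := Nat.one_div_pos_of_nat
  have hex (n : ℕ) : ∃ c, TransGen (DeltaStep f (1 / ((n : ℝ) + 1))) p c ∧
      dist (f c) y ≤ 1 / ((n : ℝ) + 1) := by
    obtain ⟨c, hc, hcy⟩ := TransGen.tail'_iff.1 (hy _ (hpos n))
    exact ⟨c, (hp _ (hpos n)).trans_left hc, hcy⟩
  choose c hc hcy using hex
  obtain ⟨w, φ, hφ, hw⟩ := CompactSpace.tendsto_subseq c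
  have hsmall : Filter.Tendsto (fun n => 1 / ((φ n : ℝ) + 1)) Filter.atTop (nhds 0) :=
    tendsto_one_div_add_atTop_nhds_zero_nat.comp hφ.tendsto_atTop
  refine ⟨w, ?_, ?_⟩
  · refine tendsto_nhds_unique ((hf.tendsto w).comp hw) ?_
    exact tendsto_iff_dist_tendsto_zero.2
      (squeeze_zero (fun _ => dist_nonneg) (fun n => hcy (φ n)) hsmall)
  · rw [chainReach_iff_transGen]
    intro δ hδ
    obtain ⟨n, hn, hn'⟩ := ((hsmall.eventually_lt_const (half_pos hδ)).and
      ((tendsto_iff_dist_tendsto_zero.1 hw).eventually_lt_const (half_pos hδ))).exists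
    have h := transGen_deltaStep_of_dist_le (transGen_deltaStep_mono hn.le (hc (φ n))) hn'.le
    rwa [add_halves] at h

/-- Lipschitz shadowing improves a `δ`-chain starting at a chain recurrent point to an
`L * δ`-chain with the same endpoints. -/
theorem LipschitzShadowingWith.transGen_mul [CompactSpace X] (hf : Continuous f) {L δ₀ δ : ℝ}
    (hL : 0 < L) (hsh : LipschitzShadowingWith f L δ₀) (hδ : 0 < δ) (hδ' : δ ≤ δ₀) {p x : X}
    (hp : ChainReach f p p) (hpx : TransGen (DeltaStep f δ) p x) :
    TransGen (DeltaStep f (L * δ)) p x := by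
  obtain ⟨c, k, ⟨hk, hc⟩, rfl, rfl⟩ := transGen_deltaStep_iff.1 hpx
  obtain ⟨z, hz⟩ := hsh δ hδ hδ' (fun i => if i ≤ k then c i else f^[i - k] (c k)) (by
    intro i
    rcases Nat.lt_or_ge i k with hik | hik
    · simpa [hik.le, Nat.succ_le_of_lt hik] using hc i hik
    · have h1 : (if i ≤ k then c i else f^[i - k] (c k)) = f^[i - k] (c k) := by
        split_ifs with h
        · obtain rfl : i = k := by omega
          simp
        · rfl
      have h2 : ¬ i + 1 ≤ k := by omega
      simp only [h1, if_neg h2]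
      rw [Nat.sub_add_comm hik, iterate_succ_apply', dist_self]
      exact hδ.le)
  have hLδ : 0 < L * δ := mul_pos hL hδ
  obtain ⟨w, hw, hpw⟩ := hp.exists_preimage hf hp
  have hwz : DeltaStep f (L * δ) w z := by
    simpa [DeltaStep, hw, dist_comm] using hz 0
  have hzk : DeltaStep f (L * δ) (f^[k - 1] z) (c k) := by
    have h := hz k
    rw [if_pos le_rfl] at h
    rwa [DeltaStep, ← iterate_succ_apply' f, Nat.succ_eq_add_one, Nat.sub_add_cancel hk]
  exact (((chainReach_iff_transGen.1 hpw _ hLδ).tail hwz).trans_left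
    (reflTransGen_deltaStep_iterate hLδ.le z (k - 1))).tail hzk

end Chains

/-- Lemma A.1: if `f` has the `L`-Lipschitz shadowing property with `0 < L < 1` and constant
`δ₀`, `C` is a chain component, `d(x, C) ≤ δ₀` and `d(f^i(x), C) → 0`, then `x ∈ C`. -/
theorem mem_chainComponent_of_lipschitzShadowing {X : Type*} [MetricSpace X] [CompactSpace X]
    (f : X → X) (hf : Continuous f) {L δ₀ : ℝ} (hL0 : 0 < L) (hL1 : L < 1) (hδ₀ : 0 < δ₀)
    (hsh : LipschitzShadowingWith f L δ₀)
    {C : Set X} (hC : C ∈ chainComponents f) {x : X}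
    (hd : infDist x C ≤ δ₀)
    (hlim : Filter.Tendsto (fun i : ℕ => infDist (f^[i] x) C) Filter.atTop (nhds 0)) :
    x ∈ C := by
  obtain ⟨p, hp, rfl⟩ := hC
  set C := {y ∈ chainRecurrentSet f | ChainReach f p y ∧ ChainReach f y p} with hCdef
  have hne : C.Nonempty := ⟨p, hp, hp, hp⟩
  have hpx : ChainReach f p x := by
    obtain ⟨y, hy, hxy⟩ :=
      (isClosed_closure (s := C)).isCompact.exists_infDist_eq_dist hne.closure x
    rw [infDist_closure] at hxy
    have hpy : ChainReach f p y := chainReach_of_mem_closure (fun q hq => hq.2.1) hy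
    obtain ⟨w, hw, hpw⟩ := ChainReach.exists_preimage hf hp hpy
    have hwx : DeltaStep f δ₀ w x := by
      rw [DeltaStep, hw, dist_comm, ← hxy]
      exact hd
    have hn (n : ℕ) : Relation.TransGen (DeltaStep f (L ^ n * δ₀)) p x := by
      induction n with
      | zero => simpa using (chainReach_iff_transGen.1 hpw δ₀ hδ₀).tail hwx
      | succ n ih =>
        rw [pow_succ', mul_assoc]
        exact hsh.transGen_mul hf hL0 (by positivity)
          (mul_le_of_le_one_left hδ₀.le (pow_le_one₀ hL0.le hL1.le)) hp ih
    rw [chainReach_iff_transGen]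
    intro δ hδ
    obtain ⟨n, hnδ⟩ := exists_pow_lt_of_lt_one (div_pos hδ hδ₀) hL1
    exact transGen_deltaStep_mono ((lt_div_iff₀ hδ₀).1 hnδ).le (hn n)
  have hxp : ChainReach f x p := by
    rw [chainReach_iff_transGen]
    intro δ hδ
    obtain ⟨i, hi, hi1⟩ :=
      ((hlim.eventually_lt_const hδ).and (Filter.eventually_ge_atTop 1)).exists
    obtain ⟨q, hq, hiq⟩ := (infDist_lt_iff hne).1 hi
    have hstep : DeltaStep f δ (f^[i - 1] x) q := by
      rw [DeltaStep, ← iterate_succ_apply' f, Nat.succ_eq_add_one, Nat.sub_add_cancel hi1]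
      exact hiq.le
    exact (Relation.TransGen.tail' (reflTransGen_deltaStep_iterate hδ.le x (i - 1)) hstep).trans
      (chainReach_iff_transGen.1 hq.2.2 δ hδ)
  exact ⟨hxp.trans hpx, hpx, hxp⟩
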